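/- arXiv:1405.6280 — 2 statements merged into one kernel-verified Lean document; each statement's English description precedes it below -/
import Mathlib

section
/- Let 𝓞 be the ring of integers of a number field and let m, n be positive integers. Then the normal closure in E of the set E(m𝓞) ∪ {T_{mx} : x ∈ 𝓞} equals E(m𝓞). -/
open NumberField Matrix

variable (K : Type*) [Field K] [NumberField K]

/-- The elementary matrix `T_x = [[1, x], [0, 1]]` in `SL(2, 𝓞)`. -/
def T (x : 𝓞 K) : Matrix.SpecialLinearGroup (Fin 2) (𝓞 K) :=
  ⟨!![1, x; 0, 1], by simp [Matrix.det_fin_two_of]⟩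

/-- The matrix `S = [[0, 1], [-1, 0]]` in `SL(2, 𝓞)`. -/
def S : Matrix.SpecialLinearGroup (Fin 2) (𝓞 K) :=
  ⟨!![0, 1; -1, 0], by simp [Matrix.det_fin_two_of]⟩

/-- `E` is the subgroup of `SL(2, 𝓞)` generated by `S` and all `T_x`, `x ∈ 𝓞`. -/
def E : Subgroup (Matrix.SpecialLinearGroup (Fin 2) (𝓞 K)) :=
  Subgroup.closure ({S K} ∪ Set.range (T K))

/-- The reduction homomorphism `SL(2, 𝓞) → SL(2, 𝓞/π)`. -/
def red (π : Ideal (𝓞 K)) :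
    Matrix.SpecialLinearGroup (Fin 2) (𝓞 K) →*
      Matrix.SpecialLinearGroup (Fin 2) ((𝓞 K) ⧸ π) :=
  Matrix.SpecialLinearGroup.map (Ideal.Quotient.mk π)

/-- The principal congruence subgroup `Γ(π)`, the kernel of reduction mod `π`. -/
def Gamma (π : Ideal (𝓞 K)) : Subgroup (Matrix.SpecialLinearGroup (Fin 2) (𝓞 K)) :=
  MonoidHom.ker (red K π)

/-- A semilocal commutative ring has stable rank one. -/
lemma IsCoprime.exists_isUnit_add_mul {R : Type*} [CommRing R] [Finite (MaximalSpectrum R)]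
    {a b : R} (h : IsCoprime a b) : ∃ t, IsUnit (a + t * b) := by
  classical
  obtain ⟨t, ht⟩ := Ideal.pi_quotient_surjective
    (I := fun M : MaximalSpectrum R => M.asIdeal)
    (fun M N hMN => Ideal.isCoprime_of_isMaximal fun e => hMN (MaximalSpectrum.ext e))
    (fun M => if a ∈ M.asIdeal then 1 else 0)
  refine ⟨t, ?_⟩
  by_contra hu
  obtain ⟨M, hM, hmem⟩ := exists_max_ideal_of_mem_nonunits hu
  have htM := ht ⟨M, hM⟩
  have hmem' : Ideal.Quotient.mk M a + Ideal.Quotient.mk M t * Ideal.Quotient.mk M b = 0 := by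
    rw [← map_mul, ← map_add]
    exact Ideal.Quotient.eq_zero_iff_mem.mpr hmem
  have htM' : Ideal.Quotient.mk M t = if a ∈ M then 1 else 0 := htM
  by_cases ha : a ∈ M
  · rw [htM', if_pos ha, Ideal.Quotient.eq_zero_iff_mem.mpr ha, zero_add, one_mul] at hmem'
    obtain ⟨x, y, hxy⟩ := h
    refine hM.ne_top ((Ideal.eq_top_iff_one _).mpr (hxy ▸ ?_))
    exact M.add_mem (M.mul_mem_left x ha)
      (M.mul_mem_left y (Ideal.Quotient.eq_zero_iff_mem.mp hmem'))
  · rw [htM', if_neg ha, zero_mul, add_zero] at hmem'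
    exact ha (Ideal.Quotient.eq_zero_iff_mem.mp hmem')

namespace Matrix.SpecialLinearGroup

variable {R : Type*} [CommRing R]

/-- The upper unipotent matrix `[[1, x], [0, 1]]`. -/
def upper (x : R) : SpecialLinearGroup (Fin 2) R :=
  ⟨!![1, x; 0, 1], by simp [det_fin_two_of]⟩

/-- The lower unipotent matrix `[[1, 0], [x, 1]]`. -/
def lower (x : R) : SpecialLinearGroup (Fin 2) R :=
  ⟨!![1, 0; x, 1], by simp [det_fin_two_of]⟩

variable (R) in
/-- The matrix `[[0, 1], [-1, 0]]`. -/
def weyl : SpecialLinearGroup (Fin 2) R :=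
  ⟨!![0, 1; -1, 0], by simp [det_fin_two_of]⟩

@[simp]
lemma coe_upper (x : R) : (upper x : Matrix (Fin 2) (Fin 2) R) = !![1, x; 0, 1] := rfl

@[simp]
lemma coe_lower (x : R) : (lower x : Matrix (Fin 2) (Fin 2) R) = !![1, 0; x, 1] := rfl

@[simp]
lemma coe_weyl : (weyl R : Matrix (Fin 2) (Fin 2) R) = !![0, 1; -1, 0] := rfl

lemma upper_inv (x : R) : (upper x)⁻¹ = upper (-x) := by
  ext i j
  rw [coe_inv]
  fin_cases i <;> fin_cases j <;> simp [adjugate_fin_two]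

lemma lower_inv (x : R) : (lower x)⁻¹ = lower (-x) := by
  ext i j
  rw [coe_inv]
  fin_cases i <;> fin_cases j <;> simp [adjugate_fin_two]

lemma lower_eq_conj (x : R) : lower x = weyl R * upper (-x) * (weyl R)⁻¹ := by
  ext i j
  rw [coe_mul, coe_mul, coe_inv]
  fin_cases i <;> fin_cases j <;>
    simp [adjugate_fin_two, mul_apply, Fin.sum_univ_two]

/-- If `d` is a unit, then an element of `SL(2, R)` is determined by its entries `b`, `c`, `d`, and
`b`, `c` can be changed arbitrarily by unipotent matrices on both sides. -/
lemma eq_upper_mul_mul_lower {A B : SpecialLinearGroup (Fin 2) R} {v : R}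
    (hv : A 1 1 * v = 1) (hd : B 1 1 = A 1 1) :
    B = upper (v * (B 0 1 - A 0 1)) * A * lower (v * (B 1 0 - A 1 0)) := by
  have hA : A 0 0 * A 1 1 - A 0 1 * A 1 0 = 1 := by rw [← det_fin_two]; exact A.2
  have hB : B 0 0 * B 1 1 - B 0 1 * B 1 0 = 1 := by rw [← det_fin_two]; exact B.2
  rw [hd] at hB
  ext i j
  rw [coe_mul, coe_mul]
  fin_cases i <;> fin_cases j <;>
    simp [mul_apply, vecMul, vecHead, vecTail, Fin.sum_univ_two]
  · linear_combination v * hB - v * hA - B 0 0 * hv + A 0 0 * hv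
      - (B 0 1 - A 0 1) * v * (B 1 0 - A 1 0) * hv
  · linear_combination (A 0 1 - B 0 1) * hv
  · linear_combination (A 1 0 - B 1 0) * hv
  · exact hd

variable {J : Ideal R} {H : Subgroup (SpecialLinearGroup (Fin 2) R)}

/-- Over a semilocal ring, a subgroup of `SL(2, R)` that is normalized by the elementary matrices
and contains the upper unipotent matrices with entry in an ideal `J` contains the whole principal
congruence subgroup of level `J`. -/
theorem mem_of_congr_one [Finite (MaximalSpectrum R)]
    (hw : weyl R ∈ Subgroup.normalizer (H : Set (SpecialLinearGroup (Fin 2) R)))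
    (hu : ∀ t, upper t ∈ Subgroup.normalizer (H : Set (SpecialLinearGroup (Fin 2) R)))
    (hJ : ∀ x ∈ J, upper x ∈ H) (A : SpecialLinearGroup (Fin 2) R)
    (h00 : A 0 0 - 1 ∈ J) (h01 : A 0 1 ∈ J) (h10 : A 1 0 ∈ J) (h11 : A 1 1 - 1 ∈ J) :
    A ∈ H := by
  have hJl : ∀ x ∈ J, lower x ∈ H := fun x hx => by
    rw [lower_eq_conj]
    exact (Subgroup.mem_normalizer_iff.mp hw _).mp (hJ _ (J.neg_mem hx))
  have hl : lower (1 : R) ∈ Subgroup.normalizer (H : Set (SpecialLinearGroup (Fin 2) R)) := by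
    rw [lower_eq_conj]
    exact mul_mem (mul_mem hw (hu _)) (inv_mem hw)
  have key : ∀ B : SpecialLinearGroup (Fin 2) R, IsUnit (B 1 1) → B 0 1 ∈ J → B 1 0 ∈ J →
      B 1 1 - 1 ∈ J → B ∈ H := by
    intro B hB hb hc hd
    obtain ⟨v, hv⟩ := hB.exists_right_inv
    -- The conjugate `C = [[1 - j, j], [-j, 1 + j]]` of `upper j` has the same last entry as `B`.
    set C := lower 1 * upper (B 1 1 - 1) * (lower (1 : R))⁻¹ with hC
    have hCH : C ∈ H := (Subgroup.mem_normalizer_iff.mp hl _).mp (hJ _ hd)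
    have hC11 : C 1 1 = B 1 1 := by
      rw [hC, lower_inv]
      simp [mul_apply, Fin.sum_univ_two]
    have hC01 : C 0 1 = B 1 1 - 1 := by
      rw [hC, lower_inv]
      simp [mul_apply, Fin.sum_univ_two]
    have hC10 : C 1 0 = -(B 1 1 - 1) := by
      rw [hC, lower_inv]
      simp [mul_apply, Fin.sum_univ_two]
      ring
    rw [eq_upper_mul_mul_lower (hC11 ▸ hv) hC11.symm]
    refine mul_mem (mul_mem (hJ _ (J.mul_mem_left _ ?_)) hCH) (hJl _ (J.mul_mem_left _ ?_))
    · rw [hC01]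
      exact J.sub_mem hb hd
    · rw [hC10]
      exact J.sub_mem hc (J.neg_mem hd)
  have hdet : A 0 0 * A 1 1 - A 0 1 * A 1 0 = 1 := by rw [← det_fin_two]; exact A.2
  have hcop : IsCoprime (A 1 1) (A 1 0) := ⟨A 0 0, -A 0 1, by linear_combination hdet⟩
  obtain ⟨t, ht⟩ := hcop.exists_isUnit_add_mul
  rw [Subgroup.mem_normalizer_iff.mp (hu (-t)) A, upper_inv, neg_neg]
  have e01 : (upper (-t) * A * upper t) 0 1 = A 0 1 + t * (A 0 0 - 1) - t * (A 1 1 - 1)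
      - t * t * A 1 0 := by
    simp [mul_apply, vecMul, vecHead, vecTail, Fin.sum_univ_two]
    ring
  have e10 : (upper (-t) * A * upper t) 1 0 = A 1 0 := by
    simp [mul_apply, vecMul, vecHead, vecTail, Fin.sum_univ_two]
  have e11 : (upper (-t) * A * upper t) 1 1 = A 1 1 + t * A 1 0 := by
    simp [mul_apply, vecMul, vecHead, vecTail, Fin.sum_univ_two]
    ring
  apply key
  · rwa [e11]
  · rw [e01]
    exact J.sub_mem (J.sub_mem (J.add_mem h01 (J.mul_mem_left _ h00)) (J.mul_mem_left _ h11))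
      (J.mul_mem_left _ h10)
  · rwa [e10]
  · rw [e11, add_sub_right_comm]
    exact J.add_mem h11 (J.mul_mem_left _ h10)

end Matrix.SpecialLinearGroup

@[simp]
lemma red_apply (F : Type*) [Field F] (π : Ideal (𝓞 F))
    (A : Matrix.SpecialLinearGroup (Fin 2) (𝓞 F)) (i j : Fin 2) :
    red F π A i j = Ideal.Quotient.mk π (A i j) := rfl

@[simp]
lemma coe_T (F : Type*) [Field F] (x : 𝓞 F) :
    (T F x : Matrix (Fin 2) (Fin 2) (𝓞 F)) = !![1, x; 0, 1] := rfl

@[simp]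
lemma coe_S (F : Type*) [Field F] :
    (S F : Matrix (Fin 2) (Fin 2) (𝓞 F)) = !![0, 1; -1, 0] := rfl

lemma red_T (F : Type*) [Field F] (π : Ideal (𝓞 F)) (x : 𝓞 F) :
    red F π (T F x) = Matrix.SpecialLinearGroup.upper (Ideal.Quotient.mk π x) := by
  ext i j
  fin_cases i <;> fin_cases j <;> simp

lemma red_S (F : Type*) [Field F] (π : Ideal (𝓞 F)) :
    red F π (S F) = Matrix.SpecialLinearGroup.weyl (𝓞 F ⧸ π) := by
  ext i j
  fin_cases i <;> fin_cases j <;> simp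

lemma T_mem_E (F : Type*) [Field F] (x : 𝓞 F) : T F x ∈ E F :=
  Subgroup.subset_closure (Or.inr ⟨x, rfl⟩)

lemma S_mem_E (F : Type*) [Field F] : S F ∈ E F := Subgroup.subset_closure (Or.inl rfl)

lemma mem_Gamma_iff (F : Type*) [Field F] (π : Ideal (𝓞 F))
    (A : Matrix.SpecialLinearGroup (Fin 2) (𝓞 F)) :
    A ∈ Gamma F π ↔ A 0 0 - 1 ∈ π ∧ A 0 1 ∈ π ∧ A 1 0 ∈ π ∧ A 1 1 - 1 ∈ π := by
  have h1 (x : 𝓞 F) : x - 1 ∈ π ↔ Ideal.Quotient.mk π x = 1 := by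
    rw [← Ideal.Quotient.eq_zero_iff_mem, map_sub, map_one, sub_eq_zero]
  rw [Gamma, MonoidHom.mem_ker, Matrix.SpecialLinearGroup.ext_iff]
  simp [Fin.forall_fin_two, h1, ← Ideal.Quotient.eq_zero_iff_mem, and_assoc]

/-- **Lemma 3.1.** For positive integers `m, n`, the normal closure in `E` of
`E((mn)𝓞) ∪ {T_{mx} : x ∈ 𝓞}` equals `E(m𝓞)`.  Here `E(π) = E ∩ Γ(π)` is viewed as the
subgroup `Γ(π).subgroupOf E` of the group `E`, and the normal closure is taken inside `E`. -/
theorem normalClosure_E (m n : ℕ) (hm : 0 < m) (hn : 0 < n) :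
    Subgroup.normalClosure
        ({x : E K | (x : Matrix.SpecialLinearGroup (Fin 2) (𝓞 K)) ∈
            Gamma K (Ideal.span {((m * n : ℕ) : 𝓞 K)})} ∪
          {x : E K | ∃ a : 𝓞 K,
            (x : Matrix.SpecialLinearGroup (Fin 2) (𝓞 K)) = T K ((m : 𝓞 K) * a)}) =
      (Gamma K (Ideal.span {((m : ℕ) : 𝓞 K)})).subgroupOf (E K) := by
  set I := Ideal.span {((m * n : ℕ) : 𝓞 K)} with hI
  set J := Ideal.span {((m : ℕ) : 𝓞 K)} with hJ
  set N := Subgroup.normalClosure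
        ({x : E K | (x : Matrix.SpecialLinearGroup (Fin 2) (𝓞 K)) ∈ Gamma K I} ∪
          {x : E K | ∃ a : 𝓞 K,
            (x : Matrix.SpecialLinearGroup (Fin 2) (𝓞 K)) = T K ((m : 𝓞 K) * a)})
  have hNI (e : E K) (he : (e : Matrix.SpecialLinearGroup (Fin 2) (𝓞 K)) ∈ Gamma K I) : e ∈ N :=
    Subgroup.subset_normalClosure (Or.inl he)
  have hNT (a : 𝓞 K) : (⟨T K (m * a), T_mem_E K _⟩ : E K) ∈ N :=
    Subgroup.subset_normalClosure (Or.inr ⟨a, rfl⟩)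
  have hIJ : I ≤ J := by
    rw [hI, hJ, Ideal.span_singleton_le_span_singleton, Nat.cast_mul]
    exact dvd_mul_right _ _
  have hmJ (a : 𝓞 K) : (m : 𝓞 K) * a ∈ J :=
    J.mul_mem_right a (Ideal.mem_span_singleton_self _)
  apply le_antisymm
  · have : (Gamma K J).Normal := MonoidHom.normal_ker _
    refine Subgroup.normalClosure_le_normal ?_
    rintro x (hx | ⟨a, ha⟩)
    · obtain ⟨h1, h2, h3, h4⟩ := (mem_Gamma_iff K I _).mp hx
      exact (mem_Gamma_iff K J _).mpr ⟨hIJ h1, hIJ h2, hIJ h3, hIJ h4⟩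
    · refine Subgroup.mem_subgroupOf.mpr ((mem_Gamma_iff K J _).mpr ?_)
      rw [ha]
      simp [hmJ a]
  intro x hx
  obtain ⟨h00, h01, h10, h11⟩ := (mem_Gamma_iff K J _).mp (Subgroup.mem_subgroupOf.mp hx)
  have hne : ((m * n : ℕ) : 𝓞 K) ≠ 0 := Nat.cast_ne_zero.mpr (Nat.mul_pos hm hn).ne'
  have : Finite (𝓞 K ⧸ I) :=
    Ring.HasFiniteQuotients.finiteQuotient (by rwa [hI, Ne, Ideal.span_singleton_eq_bot])
  obtain ⟨ψ, hψ⟩ : ∃ ψ : E K →* _, ∀ e, ψ e = red K I e :=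
    ⟨(red K I).comp (E K).subtype, fun _ => rfl⟩
  have hE (g) (hg : g ∈ E K) : red K I g ∈ Subgroup.normalizer
      (N.map ψ : Set (Matrix.SpecialLinearGroup (Fin 2) (𝓞 K ⧸ I))) := by
    rw [← hψ ⟨g, hg⟩]
    apply N.le_normalizer_map ψ
    rw [Subgroup.normalizer_eq_top]
    exact Subgroup.mem_map_of_mem ψ (Subgroup.mem_top _)
  have hmem : ψ x ∈ N.map ψ := by
    have hψx (i j) : ψ x i j = Ideal.Quotient.mk I (x.1 i j) := by rw [hψ, red_apply]
    have hmap {y : 𝓞 K} (hy : y ∈ J) := Ideal.mem_map_of_mem (Ideal.Quotient.mk I) hy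
    refine Matrix.SpecialLinearGroup.mem_of_congr_one (J := J.map (Ideal.Quotient.mk I)) ?_ ?_ ?_ _
      (by simpa [hψx] using hmap h00) (by simpa [hψx] using hmap h01)
      (by simpa [hψx] using hmap h10) (by simpa [hψx] using hmap h11)
    · rw [← red_S]
      exact hE _ (S_mem_E K)
    · intro t
      obtain ⟨t, rfl⟩ := Ideal.Quotient.mk_surjective t
      rw [← red_T]
      exact hE _ (T_mem_E K t)
    · intro y hy
      obtain ⟨y, hyJ, rfl⟩ := Ideal.mem_image_of_mem_map_of_surjective (Ideal.Quotient.mk I)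
        Ideal.Quotient.mk_surjective hy
      obtain ⟨a, rfl⟩ := Ideal.mem_span_singleton.mp hyJ
      rw [← red_T]
      exact ⟨_, hNT a, hψ _⟩
  obtain ⟨y, hy, hyx⟩ := hmem
  have hker : y⁻¹ * x ∈ N := by
    refine hNI _ ?_
    rw [Gamma, MonoidHom.mem_ker, ← hψ, map_mul, map_inv, hyx, inv_mul_cancel]
  simpa using mul_mem hy hker
end

section
/- Let d < 0 be a squarefree integer with d ∉ {−1, −3}, let O_d be the ring of integers of ℚ(√d), and let B_d = PSL(2, O_d). Let q be a rational prime that is inert in O_d, or such that q ≥ 5 and q is split in O_d. Then B_d has a normal non-congruence subgroup of index q and level q. -/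
set_option linter.unusedSectionVars false

open NumberField Matrix

instance : Fact (Even (Fintype.card (Fin 2))) := ⟨⟨1, rfl⟩⟩

variable (K : Type*) [Field K] [NumberField K]

/-- The subgroup `{±I}` of `SL(2, 𝓞)`, generated by `-I`. -/
def PM : Subgroup (Matrix.SpecialLinearGroup (Fin 2) (𝓞 K)) :=
  Subgroup.closure {(-1 : Matrix.SpecialLinearGroup (Fin 2) (𝓞 K))}

theorem PM_le_center : PM K ≤ Subgroup.center (Matrix.SpecialLinearGroup (Fin 2) (𝓞 K)) := by
  rw [PM, Subgroup.closure_le]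
  rintro x rfl
  rw [SetLike.mem_coe, Subgroup.mem_center_iff]
  intro g
  ext i j
  simp [Matrix.SpecialLinearGroup.coe_mul]

instance PM_normal : (PM K).Normal := by
  constructor
  intro n hn g
  have hc := PM_le_center K hn
  rw [Subgroup.mem_center_iff] at hc
  rw [hc g, mul_assoc, mul_inv_cancel, mul_one]
  exact hn

/-- `PSL(2, 𝓞)`, the quotient of `SL(2, 𝓞)` by `{±I}`. -/
def PSL := Matrix.SpecialLinearGroup (Fin 2) (𝓞 K) ⧸ PM K

instance : Group (PSL K) := QuotientGroup.Quotient.group (PM K)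

/-- The projection `SL(2, 𝓞) → PSL(2, 𝓞)`. -/
def proj : Matrix.SpecialLinearGroup (Fin 2) (𝓞 K) →* PSL K :=
  QuotientGroup.mk' (PM K)

/-- The principal congruence subgroup `Ḡ(π)` of `PSL(2,𝓞)` : the image in `PSL(2,𝓞)` of
`{A ∈ SL(2,𝓞) : A ≡ ±I (mod π)}`, the set of matrices reducing to `±I` modulo `π`. -/
def Gbar (π : Ideal (𝓞 K)) : Subgroup (PSL K) :=
  Subgroup.map (proj K)
    (Subgroup.comap (red K π)
      (Subgroup.closure {(-1 : Matrix.SpecialLinearGroup (Fin 2) ((𝓞 K) ⧸ π))}))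

/-- A subgroup of `G = PSL(2,𝓞)` is a congruence subgroup if it contains `Ḡ(π)` for some
nonzero ideal `π` of `𝓞`. -/
def IsCongruence (H : Subgroup (PSL K)) : Prop :=
  ∃ π : Ideal (𝓞 K), π ≠ ⊥ ∧ Gbar K π ≤ H

/-- The normal closure in `PSL(2,𝓞)` of the images of the matrices `T_{mx}`, `x ∈ 𝓞`. -/
def TclosureP (m : ℕ) : Subgroup (PSL K) :=
  Subgroup.normalClosure {x : PSL K | ∃ a : 𝓞 K, x = proj K (T K ((m : 𝓞 K) * a))}

/-- `H ≤ PSL(2,𝓞)` has level `m` : `m` is the smallest positive integer such that the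
normal closure in `PSL(2,𝓞)` of the images of `{T_{mx} : x ∈ 𝓞}` is contained in `H`. -/
def HasLevelP (H : Subgroup (PSL K)) (m : ℕ) : Prop :=
  0 < m ∧ TclosureP K m ≤ H ∧ ∀ k : ℕ, 0 < k → TclosureP K k ≤ H → m ≤ k

/-- A rational prime `q` is inert in `𝓞` if `q𝓞` is a prime ideal. -/
def Inert (q : ℕ) : Prop := (Ideal.span {(q : 𝓞 K)}).IsPrime

/-- A rational prime `q` is split in `𝓞` if `q𝓞` is a product of at least two distinct
prime ideals, each occurring with multiplicity one; equivalently `q𝓞` is squarefree and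
not itself prime. -/
def Split (q : ℕ) : Prop :=
  Squarefree (Ideal.span {(q : 𝓞 K)}) ∧ ¬(Ideal.span {(q : 𝓞 K)}).IsPrime

/-- A ring with an involution which behaves like the ring of integers of an imaginary quadratic
field of discriminant `D`: `tau` is the coordinate along `ω` in the basis `1, ω`. -/
structure ImagQuadData (R : Type*) [CommRing R] where
  conj : R →+* R
  conj_conj : ∀ x, conj (conj x) = x
  tau : R →+ ℤ
  tr : R → ℤ
  nrm : R → ℤ
  ω : R
  D : ℤ
  D_le : D ≤ -5
  disc : (ω - conj ω) * (ω - conj ω) = D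
  tau_ω : tau ω = 1
  sub_conj : ∀ x, x - conj x = tau x * (ω - conj ω)
  add_conj : ∀ x, x + conj x = tr x
  mul_conj : ∀ x, x * conj x = nrm x

namespace ImagQuadData

variable {R : Type*} [CommRing R] [IsDomain R] [CharZero R] (Q : ImagQuadData R)

def s : R := Q.ω - Q.conj Q.ω

lemma conj_s : Q.conj Q.s = -Q.s := by simp [s, Q.conj_conj]

lemma s_mul_s : Q.s * Q.s = Q.D := Q.disc

lemma sub_conj' (x : R) : x - Q.conj x = Q.tau x * Q.s := Q.sub_conj x

lemma s_ne_zero : Q.s ≠ 0 := by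
  intro h
  have h1 := Q.s_mul_s
  rw [h, mul_zero] at h1
  have h2 : Q.D = 0 := by exact_mod_cast h1.symm
  have := Q.D_le
  omega

lemma tau_eq_of {x : R} {n : ℤ} (h : x - Q.conj x = n * Q.s) : Q.tau x = n := by
  rw [Q.sub_conj'] at h
  exact_mod_cast mul_right_cancel₀ Q.s_ne_zero h

lemma tau_int_mul_s (n : ℤ) : Q.tau (n * Q.s) = 2 * n := by
  apply Q.tau_eq_of
  simp only [map_mul, map_intCast, Q.conj_s]
  push_cast; ring

lemma four_mul_nrm (x : R) : 4 * Q.nrm x = Q.tr x ^ 2 - Q.D * Q.tau x ^ 2 := by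
  have : ((4 * Q.nrm x : ℤ) : R) = ((Q.tr x ^ 2 - Q.D * Q.tau x ^ 2 : ℤ) : R) := by
    push_cast
    rw [← Q.mul_conj, ← Q.add_conj, ← Q.s_mul_s]
    linear_combination (-(x - Q.conj x) - Q.tau x * Q.s) * Q.sub_conj' x
  exact_mod_cast this

lemma nrm_mul (x y : R) : Q.nrm (x * y) = Q.nrm x * Q.nrm y := by
  have : ((Q.nrm (x * y) : ℤ) : R) = ((Q.nrm x * Q.nrm y : ℤ) : R) := by
    push_cast
    simp only [← Q.mul_conj, map_mul]
    ring
  exact_mod_cast this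

lemma tau_sq_le (x : R) : -Q.D * Q.tau x ^ 2 ≤ 4 * Q.nrm x := by
  nlinarith [Q.four_mul_nrm x, sq_nonneg (Q.tr x)]

lemma nrm_nonneg (x : R) : 0 ≤ Q.nrm x := by
  nlinarith [Q.four_mul_nrm x, sq_nonneg (Q.tr x), Q.D_le, sq_nonneg (Q.tau x)]

lemma two_mul_eq (x : R) : 2 * x = Q.tr x + Q.tau x * Q.s := by
  rw [← Q.add_conj, ← Q.sub_conj']; ring

lemma ext_tr_tau {x y : R} (h1 : Q.tr x = Q.tr y) (h2 : Q.tau x = Q.tau y) : x = y := by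
  have : (2 : R) * x = 2 * y := by rw [Q.two_mul_eq, Q.two_mul_eq y, h1, h2]
  exact mul_left_cancel₀ two_ne_zero this

lemma finite_nrm_le (B : ℤ) : {x : R | Q.nrm x ≤ B}.Finite := by
  have hf : ((Set.Icc (-(4 * B)) (4 * B)) ×ˢ (Set.Icc (-(4 * B)) (4 * B))).Finite :=
    (Set.finite_Icc _ _).prod (Set.finite_Icc _ _)
  refine Set.Finite.of_finite_image (f := fun x => (Q.tr x, Q.tau x)) (hf.subset ?_) ?_
  · rintro _ ⟨x, hx, rfl⟩
    have h := Q.four_mul_nrm x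
    have hD := Q.D_le
    have hx' : Q.nrm x ≤ B := hx
    have h1 : Q.tr x ^ 2 ≤ 4 * B := by nlinarith [sq_nonneg (Q.tau x)]
    have h2 : Q.tau x ^ 2 ≤ 4 * B := by nlinarith [sq_nonneg (Q.tau x), sq_nonneg (Q.tr x)]
    have key : ∀ z : ℤ, z ^ 2 ≤ 4 * B → z ∈ Set.Icc (-(4 * B)) (4 * B) := fun z hz =>
      ⟨by nlinarith [Int.le_self_sq (-z)], by nlinarith [Int.le_self_sq z]⟩
    exact ⟨key _ h1, key _ h2⟩
  · intro x _ y _ h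
    simp only [Prod.mk.injEq] at h
    exact Q.ext_tr_tau h.1 h.2

/-- The right action `M ↦ g* M g` of `SL₂` on matrices. -/
def act (g : Matrix.SpecialLinearGroup (Fin 2) R) (M : Matrix (Fin 2) (Fin 2) R) :
    Matrix (Fin 2) (Fin 2) R :=
  ((g : Matrix (Fin 2) (Fin 2) R).map Q.conj)ᵀ * M * (g : Matrix (Fin 2) (Fin 2) R)

lemma act_mul (g h : Matrix.SpecialLinearGroup (Fin 2) R) (M : Matrix (Fin 2) (Fin 2) R) :
    Q.act (g * h) M = Q.act h (Q.act g M) := by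
  simp only [act, Matrix.SpecialLinearGroup.coe_mul, Matrix.map_mul, Matrix.transpose_mul,
    Matrix.mul_assoc]

lemma act_one (M : Matrix (Fin 2) (Fin 2) R) : Q.act 1 M = M := by
  simp [act]

lemma act_neg_one (M : Matrix (Fin 2) (Fin 2) R) : Q.act (-1) M = M := by
  ext i j
  fin_cases i <;> fin_cases j <;> simp [act, Matrix.mul_apply, Fin.sum_univ_two]

/-- The orbit of the standard skew-Hermitian form: it indexes the translates of the
hyperbolic plane lying over the real line. -/
def planes : Set (Matrix (Fin 2) (Fin 2) R) :=
  Set.range fun g => Q.act g !![0, 1; -1, 0]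

lemma act_mem_planes (g : Matrix.SpecialLinearGroup (Fin 2) R) {M : Matrix (Fin 2) (Fin 2) R}
    (hM : M ∈ Q.planes) : Q.act g M ∈ Q.planes := by
  obtain ⟨h, rfl⟩ := hM
  exact ⟨h * g, Q.act_mul _ _ _⟩

/-- The permutation of the planes induced by a group element. -/
def planesEquiv (g : Matrix.SpecialLinearGroup (Fin 2) R) : Q.planes ≃ Q.planes where
  toFun M := ⟨Q.act g M, Q.act_mem_planes g M.2⟩
  invFun M := ⟨Q.act g⁻¹ M, Q.act_mem_planes g⁻¹ M.2⟩
  left_inv M := by ext1; simp only [← Q.act_mul, mul_inv_cancel, Q.act_one]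
  right_inv M := by ext1; simp only [← Q.act_mul, inv_mul_cancel, Q.act_one]

lemma exists_of_mem_planes {M : Matrix (Fin 2) (Fin 2) R} (hM : M ∈ Q.planes) :
    ∃ (a c : ℤ) (β γ : R), M = !![a * Q.s, β; -Q.conj β, c * Q.s] ∧
      a * c * Q.D + Q.nrm β = 1 ∧ β = 1 + Q.s * γ := by
  obtain ⟨g, rfl⟩ := hM
  obtain ⟨p, q, r, t, h, rfl⟩ : ∃ p q r t : R, ∃ h : p * t - q * r = 1,
      g = ⟨!![p, q; r, t], by rw [Matrix.det_fin_two_of, h]⟩ :=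
    ⟨g 0 0, g 0 1, g 1 0, g 1 1, (Matrix.det_fin_two _).symm.trans g.det_coe, by
      ext i j; fin_cases i <;> fin_cases j <;> rfl⟩
  have h' := congrArg Q.conj h
  simp only [map_sub, map_mul, map_one] at h'
  have ha := Q.sub_conj' (Q.conj p * r)
  have hc := Q.sub_conj' (Q.conj q * t)
  simp only [map_mul, Q.conj_conj] at ha hc
  refine ⟨Q.tau (Q.conj p * r), Q.tau (Q.conj q * t), Q.conj p * t - Q.conj r * q,
    Q.tau r * q - Q.tau p * t, ?_, ?_, ?_⟩
  · rw [← ha, ← hc]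
    ext i j
    fin_cases i <;> fin_cases j <;>
      simp [act, Matrix.mul_apply, Fin.sum_univ_two, Q.conj_conj] <;> ring
  · have : ((Q.tau (Q.conj p * r) * Q.tau (Q.conj q * t) * Q.D +
        Q.nrm (Q.conj p * t - Q.conj r * q) : ℤ) : R) = ((1 : ℤ) : R) := by
      push_cast
      rw [← Q.mul_conj, ← Q.s_mul_s]
      simp only [map_sub, map_mul, Q.conj_conj]
      linear_combination (-(Q.tau (Q.conj q * t) : R) * Q.s) * ha -
        (Q.conj p * r - p * Q.conj r) * hc + (Q.conj p * Q.conj t - Q.conj q * Q.conj r) * h + h'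
    exact_mod_cast this
  · linear_combination (-t) * Q.sub_conj' p + q * Q.sub_conj' r + h

/-- The indicator of the planes lying on the positive side of the base point. -/
noncomputable def side (M : Matrix (Fin 2) (Fin 2) R) : ℤ :=
  if 0 ≤ Q.tau (M 0 0) + Q.tau (M 1 1) then 1 else 0

lemma side_form (a c : ℤ) (β β' : R) :
    Q.side !![a * Q.s, β; β', c * Q.s] = if 0 ≤ a + c then 1 else 0 := by
  have : Q.side !![a * Q.s, β; β', c * Q.s] = if 0 ≤ 2 * a + 2 * c then 1 else 0 := by
    simp [side, Q.tau_int_mul_s]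
  rw [this]
  split_ifs <;> omega

lemma mul_nonneg_of_det {a c : ℤ} {β : R} (h : a * c * Q.D + Q.nrm β = 1) : 0 ≤ a * c := by
  by_contra! h0
  nlinarith [Q.D_le, Q.nrm_nonneg β]

lemma bound_of_crossing {a c A C E w n m : ℤ} (hE : 5 ≤ E) (hac : 0 ≤ a * c) (hA : 0 ≤ A)
    (hC : 0 ≤ C) (hm : A * C - m = 1) (hm0 : 0 ≤ m) (hn : n = 1 + a * c * E)
    (hw : E * w ^ 2 ≤ 4 * (n * m)) (hle : (a * A + c * C) ^ 2 ≤ w ^ 2) :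
    a ^ 2 ≤ 4 * (A * C) * (1 + A * C) ∧ c ^ 2 ≤ 4 * (A * C) * (1 + A * C) ∧
      n ≤ 1 + A * C := by
  have hm' : m = A * C - 1 := by linarith
  subst hm' hn
  have hAC : 1 ≤ A * C := by linarith
  have hA1 : 1 ≤ A := by
    by_contra! h
    have : A = 0 := by omega
    subst this
    omega
  have hC1 : 1 ≤ C := by
    by_contra! h
    have : C = 0 := by omega
    subst this
    omega
  have h1 : E * (a * A + c * C) ^ 2 ≤ 4 * ((1 + a * c * E) * (A * C - 1)) :=
    (mul_le_mul_of_nonneg_left hle (by omega)).trans hw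
  have hsq : 0 ≤ E * (a * A - c * C) ^ 2 := by positivity
  have h2 : a * c * E ≤ A * C := by nlinarith
  have h3 : E * (a * A + c * C) ^ 2 ≤ E * (4 * (A * C) * (1 + A * C)) := by
    have : (1 + a * c * E) * (A * C - 1) ≤ (1 + A * C) * (A * C) := by
      apply mul_le_mul <;> nlinarith
    have h0 : 0 ≤ (A * C) * (1 + A * C) := by positivity
    nlinarith
  have h4 := le_of_mul_le_mul_left h3 (by omega)
  have h5 : 0 ≤ a * c * (A * C) := by positivity
  refine ⟨?_, ?_, by linarith⟩
  · nlinarith [mul_nonneg (sq_nonneg a) (show 0 ≤ A ^ 2 - 1 by nlinarith), sq_nonneg (c * C)]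
  · nlinarith [mul_nonneg (sq_nonneg c) (show 0 ≤ C ^ 2 - 1 by nlinarith), sq_nonneg (a * A)]

lemma finite_crossed (g : Matrix.SpecialLinearGroup (Fin 2) R) :
    {M : Q.planes | Q.side (Q.act g M) - Q.side M ≠ 0}.Finite := by
  set A := Q.nrm (g 0 0) + Q.nrm (g 0 1) with hA
  set C := Q.nrm (g 1 0) + Q.nrm (g 1 1) with hC
  set B := Q.conj (g 0 0) * g 1 0 + Q.conj (g 0 1) * g 1 1 with hB
  have hdet : g 0 0 * g 1 1 - g 0 1 * g 1 0 = 1 := (Matrix.det_fin_two _).symm.trans g.det_coe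
  have hdet' := congrArg Q.conj hdet
  simp only [map_sub, map_mul, map_one] at hdet'
  have hAC : A * C - Q.nrm B = 1 := by
    have : ((A * C - Q.nrm B : ℤ) : R) = ((1 : ℤ) : R) := by
      rw [hA, hC]
      push_cast
      simp only [← Q.mul_conj]
      rw [hB]
      simp only [map_add, map_mul, Q.conj_conj]
      linear_combination (Q.conj (g 0 0) * Q.conj (g 1 1) - Q.conj (g 0 1) * Q.conj (g 1 0)) *
        hdet + hdet'
    exact_mod_cast this
  set L := 4 * (A * C) * (1 + A * C) with hL
  have hfin : ((Set.Icc (-L) L) ×ˢ ((Set.Icc (-L) L) ×ˢ {x : R | Q.nrm x ≤ 1 + A * C})).Finite :=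
    (Set.finite_Icc _ _).prod ((Set.finite_Icc _ _).prod (Q.finite_nrm_le _))
  refine Set.Finite.of_finite_image (f := Subtype.val) ?_ Subtype.val_injective.injOn
  refine (hfin.image fun x => !![(x.1 : R) * Q.s, x.2.2; -Q.conj x.2.2, x.2.1 * Q.s]).subset ?_
  rintro _ ⟨⟨M, hM⟩, hne, rfl⟩
  obtain ⟨a', c', β', -, hM', -, -⟩ := Q.exists_of_mem_planes (Q.act_mem_planes g hM)
  obtain ⟨a, c, β, -, rfl, hd, -⟩ := Q.exists_of_mem_planes hM
  simp only [Set.mem_ofPred_eq] at hne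
  have hsum : a' + c' = a * A + c * C + Q.tau (β * B) := by
    have h0 := congrFun (congrFun hM' 0) 0
    have h1 := congrFun (congrFun hM' 1) 1
    simp [act, Matrix.mul_apply, Fin.sum_univ_two] at h0 h1
    have ht := Q.sub_conj' (β * B)
    rw [hB] at ht
    simp only [map_add, map_mul, Q.conj_conj] at ht
    have : ((a' + c' : ℤ) : R) * Q.s = ((a * A + c * C + Q.tau (β * B) : ℤ) : R) * Q.s := by
      rw [hA, hC]
      push_cast
      simp only [← Q.mul_conj]
      linear_combination -h0 - h1 + ht
    exact_mod_cast mul_right_cancel₀ Q.s_ne_zero this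
  rw [hM', Q.side_form, Q.side_form] at hne
  have hac := Q.mul_nonneg_of_det hd
  have hA0 : 0 ≤ A := add_nonneg (Q.nrm_nonneg _) (Q.nrm_nonneg _)
  have hC0 : 0 ≤ C := add_nonneg (Q.nrm_nonneg _) (Q.nrm_nonneg _)
  have hw := Q.tau_sq_le (β * B)
  rw [Q.nrm_mul] at hw
  have hle : (a * A + c * C) ^ 2 ≤ Q.tau (β * B) ^ 2 := by
    by_cases h : 0 ≤ a + c
    · have hn : ¬ 0 ≤ a' + c' := fun h' => hne (by simp [h, h'])
      have ha : 0 ≤ a := by nlinarith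
      have hc : 0 ≤ c := by nlinarith
      have := mul_nonneg ha hA0
      have := mul_nonneg hc hC0
      nlinarith
    · have hn : 0 ≤ a' + c' := by by_contra h'; exact hne (by simp [h, h'])
      have ha : a ≤ 0 := by nlinarith
      have hc : c ≤ 0 := by nlinarith
      have := mul_nonneg (neg_nonneg.2 ha) hA0
      have := mul_nonneg (neg_nonneg.2 hc) hC0
      nlinarith
  obtain ⟨h1, h2, h3⟩ := bound_of_crossing (E := -Q.D) (n := Q.nrm β) (by linarith [Q.D_le]) hac
    hA0 hC0 hAC (Q.nrm_nonneg B) (by linarith) hw hle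
  have key : ∀ z : ℤ, z ^ 2 ≤ L → z ∈ Set.Icc (-L) L := fun z hz =>
    ⟨by nlinarith [Int.le_self_sq (-z)], by nlinarith [Int.le_self_sq z]⟩
  exact ⟨(a, c, β), ⟨key _ h1, key _ h2, h3⟩, rfl⟩

/-- The signed number of planes crossed by a path from the base point to its translate. -/
noncomputable def crossing (g : Matrix.SpecialLinearGroup (Fin 2) R) : ℤ :=
  ∑ᶠ M : Q.planes, (Q.side (Q.act g M) - Q.side M)

lemma crossing_mul (g h : Matrix.SpecialLinearGroup (Fin 2) R) :
    Q.crossing (g * h) = Q.crossing g + Q.crossing h := by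
  have e : Q.crossing h =
      ∑ᶠ M : Q.planes, (Q.side (Q.act h (Q.act g M)) - Q.side (Q.act g M)) :=
    (finsum_comp_equiv (Q.planesEquiv g)
      (f := fun M : Q.planes => Q.side (Q.act h M) - Q.side M)).symm
  rw [e, crossing, crossing, ← finsum_add_distrib (Q.finite_crossed g)]
  · refine finsum_congr fun M => ?_
    rw [Q.act_mul]; ring
  · exact (Q.finite_crossed h).preimage (Q.planesEquiv g).injective.injOn

lemma crossing_neg_one : Q.crossing (-1) = 0 := by
  simp [crossing, Q.act_neg_one]

lemma eq_one_of_nrm_eq_one {β γ : R} (h : Q.nrm β = 1) (hβ : β = 1 + Q.s * γ) : β = 1 := by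
  have h4 := Q.four_mul_nrm β
  rw [h] at h4
  have hD := Q.D_le
  have ht : Q.tau β = 0 := by
    by_contra h0
    have : 0 < Q.tau β ^ 2 := by positivity
    nlinarith [sq_nonneg (Q.tr β)]
  have h2 := Q.two_mul_eq β
  rw [ht] at h2 h4
  have h5 : (Q.tr β - 2) * (Q.tr β + 2) = 0 := by linarith
  rcases mul_eq_zero.1 h5 with h6 | h6
  · have h7 : Q.tr β = 2 := by omega
    rw [h7] at h2
    push_cast at h2
    exact mul_left_cancel₀ two_ne_zero (by linear_combination h2)
  · exfalso
    have h7 : Q.tr β = -2 := by omega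
    rw [h7] at h2
    push_cast at h2
    have h8 : Q.s * γ = ((-2 : ℤ) : R) := by
      apply mul_left_cancel₀ (two_ne_zero (α := R))
      push_cast
      linear_combination h2 - 2 * hβ
    have h9 : Q.nrm Q.s * Q.nrm γ = 4 := by
      rw [← Q.nrm_mul, h8]
      have : ((Q.nrm ((-2 : ℤ) : R) : ℤ) : R) = ((4 : ℤ) : R) := by
        rw [← Q.mul_conj]
        simp only [map_intCast]
        norm_num
      exact_mod_cast this
    have h10 : Q.nrm Q.s = -Q.D := by
      have : ((Q.nrm Q.s : ℤ) : R) = ((-Q.D : ℤ) : R) := by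
        rw [← Q.mul_conj, Q.conj_s]
        push_cast
        linear_combination -Q.s_mul_s
      exact_mod_cast this
    have h11 := Q.nrm_nonneg γ
    rw [h10] at h9
    rcases h11.eq_or_lt with h12 | h12
    · rw [← h12] at h9; omega
    · nlinarith

lemma crossing_upper (t : Matrix.SpecialLinearGroup (Fin 2) R)
    (ht : (t : Matrix (Fin 2) (Fin 2) R) = !![1, Q.ω; 0, 1]) :
    Q.crossing t = -1 := by
  have hact : ∀ (a c : ℤ) (β : R), Q.act t !![a * Q.s, β; -Q.conj β, c * Q.s] =
      !![a * Q.s, β + a * Q.s * Q.ω; -Q.conj β + Q.conj Q.ω * (a * Q.s),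
        Q.conj Q.ω * (a * Q.s * Q.ω + β) + (-Q.conj β * Q.ω + c * Q.s)] := by
    intro a c β
    rw [act, ht]
    ext i j
    fin_cases i <;> fin_cases j <;> simp [Matrix.mul_apply, Fin.sum_univ_two] <;> ring
  have hJ : (!![0, 1; -1, 0] : Matrix (Fin 2) (Fin 2) R) ∈ Q.planes := ⟨1, Q.act_one _⟩
  have hJs : Q.side !![0, 1; -1, 0] = 1 := by simp [side]
  have hzero : ∀ c : ℤ, Q.act t !![(0 : ℤ) * Q.s, 1; -Q.conj 1, c * Q.s] =
      !![(0 : ℤ) * Q.s, 1; -Q.conj 1, ((c - 1 : ℤ) : R) * Q.s] := by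
    intro c
    rw [hact]
    ext i j
    fin_cases i <;> fin_cases j <;> simp [s]
    ring
  have hJt : Q.side (Q.act t !![0, 1; -1, 0]) = 0 := by
    have h := hzero 0
    have h' : Q.side (Q.act t !![(0 : ℤ) * Q.s, 1; -Q.conj 1, (0 : ℤ) * Q.s]) = 0 := by
      rw [h, Q.side_form]; norm_num
    simpa using h'
  rw [crossing, finsum_eq_single _ ⟨_, hJ⟩]
  · simp only [hJs, hJt]; norm_num
  · rintro ⟨M, hM⟩ hne
    obtain ⟨a', c', β', -, hM', hd', -⟩ := Q.exists_of_mem_planes (Q.act_mem_planes t hM)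
    obtain ⟨a, c, β, γ, rfl, hd, hβ⟩ := Q.exists_of_mem_planes hM
    have hac := Q.mul_nonneg_of_det hd
    have hac' := Q.mul_nonneg_of_det hd'
    have haa : a = a' := by
      have h := congrFun (congrFun hM' 0) 0
      rw [hact] at h
      simpa [Q.s_ne_zero] using h
    subst haa
    by_cases ha : a = 0
    · subst ha
      have hβ1 : β = 1 := Q.eq_one_of_nrm_eq_one (by linarith) hβ
      subst hβ1
      simp only [hzero]
      rw [Q.side_form, Q.side_form]
      have hc : c ≠ 0 := by
        rintro rfl
        apply hne
        simp
      split_ifs <;> omega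
    · simp only [hM']
      rw [Q.side_form, Q.side_form]
      have : 0 ≤ a + c ↔ 0 ≤ a + c' := by
        rcases lt_or_gt_of_ne ha with h | h
        · have h1 : c ≤ 0 := by nlinarith
          have h2 : c' ≤ 0 := by nlinarith
          constructor <;> intro <;> omega
        · have h1 : 0 ≤ c := by nlinarith
          have h2 : 0 ≤ c' := by nlinarith
          constructor <;> intro <;> omega
      simp [this]

end ImagQuadData

lemma discriminant_le {d D g : ℤ} (hd : d < 0) (hdsf : Squarefree d) (hd1 : d ≠ -1)
    (hd3 : d ≠ -3) (hg : g ≠ 0) (h : D * d = g ^ 2) {t n : ℤ} (hD : D = t ^ 2 - 4 * n) :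
    D ≤ -5 := by
  have hneg : D < 0 := by
    have : 0 < g ^ 2 := by positivity
    nlinarith
  have hmod : D % 4 = 0 ∨ D % 4 = 1 := by
    obtain ⟨k, hk⟩ : ∃ k, D = t ^ 2 - 4 * k := ⟨n, hD⟩
    rcases Int.even_or_odd' t with ⟨m, rfl | rfl⟩
    · left; rw [hk]; ring_nf; omega
    · right; rw [hk]; ring_nf; omega
  have hsq : ∀ m : ℤ, m * m ∣ d → m ^ 2 = 1 := fun m hm => by
    rcases Int.isUnit_iff.1 (hdsf m hm) with rfl | rfl <;> norm_num
  by_contra! hlt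
  have h34 : D = -4 ∨ D = -3 := by omega
  rcases h34 with rfl | rfl
  · obtain ⟨m, rfl⟩ : (2 : ℤ) ∣ g :=
      Int.prime_two.dvd_of_dvd_pow (n := 2) ⟨-2 * d, by linarith⟩
    have h1 : d = -(m * m) := by linarith
    have := hsq m (h1 ▸ (dvd_neg.2 dvd_rfl))
    apply hd1; linarith
  · obtain ⟨m, rfl⟩ : (3 : ℤ) ∣ g :=
      Int.prime_three.dvd_of_dvd_pow (n := 2) ⟨-d, by linarith⟩
    have h1 : d = m * m * (-3) := by linarith
    have := hsq m (h1 ▸ dvd_mul_right _ _)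
    apply hd3; linarith

theorem exists_imagQuadData (K : Type*) [Field K] [NumberField K]
    (d : ℤ) (hd : d < 0) (hdsf : Squarefree d) (hd1 : d ≠ -1) (hd3 : d ≠ -3)
    (hK2 : Module.finrank ℚ K = 2) (α : K) (hα : α ^ 2 = (d : K)) :
    Nonempty (ImagQuadData (𝓞 K)) := by
  have : Algebra.IsQuadraticExtension ℚ K := ⟨hK2⟩
  have hcard : Nat.card Gal(K/ℚ) = 2 := by rw [IsGalois.card_aut_eq_finrank, hK2]
  obtain ⟨σ, hσ⟩ : ∃ σ : Gal(K/ℚ), σ ≠ 1 := by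
    have : Nontrivial Gal(K/ℚ) := Finite.one_lt_card_iff_nontrivial.1 (by omega)
    exact exists_ne 1
  have hall : ∀ τ : Gal(K/ℚ), τ = 1 ∨ τ = σ := by
    intro τ
    obtain ⟨y, -, hy⟩ := (Nat.card_eq_two_iff' (1 : Gal(K/ℚ))).1 hcard
    by_cases h : τ = 1
    · exact Or.inl h
    · exact Or.inr ((hy τ h).trans (hy σ hσ).symm)
  have hσσ : ∀ x, σ (σ x) = x := by
    intro x
    have h : σ * σ = 1 := by rw [← sq, ← hcard, pow_card_eq_one']
    exact DFunLike.congr_fun h x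
  have hfix : ∀ x : K, σ x = x → ∃ r : ℚ, algebraMap ℚ K r = x := by
    intro x hx
    have := (IsGalois.mem_bot_iff_fixed (F := ℚ) (E := K) x).2 (fun τ => by
      rcases hall τ with rfl | rfl
      · rfl
      · exact hx)
    exact IntermediateField.mem_bot.1 this
  have hα0 : α ≠ 0 := by
    rintro rfl
    have : (d : K) = 0 := by rw [← hα]; norm_num
    have : d = 0 := by exact_mod_cast this
    omega
  have hσα : σ α = -α := by
    have h : σ α ^ 2 = α ^ 2 := by rw [← map_pow, hα, map_intCast]
    rcases sq_eq_sq_iff_eq_or_eq_neg.1 h with h | h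
    · exfalso
      obtain ⟨r, rfl⟩ := hfix α h
      have h1 : algebraMap ℚ K (r ^ 2) = algebraMap ℚ K d := by rw [map_pow, hα, map_intCast]
      have h2 : r ^ 2 = d := (algebraMap ℚ K).injective h1
      have h3 : (d : ℚ) < 0 := by exact_mod_cast hd
      nlinarith [sq_nonneg r]
    · exact h
  have hαint : IsIntegral ℤ α := by
    refine IsIntegral.of_pow (n := 2) (by norm_num) ?_
    rw [hα]
    exact isIntegral_algebraMap (R := ℤ) (x := d)
  let a : 𝓞 K := ⟨α, hαint⟩
  let c : 𝓞 K →+* 𝓞 K := RingOfIntegers.mapRingHom (σ : K →+* K)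
  have hc : ∀ x : 𝓞 K, ((c x : 𝓞 K) : K) = σ x := fun x => rfl
  have hcc : ∀ x, c (c x) = x := fun x => by
    apply RingOfIntegers.ext; rw [hc, hc, hσσ]
  have hca : c a = -a := by
    apply RingOfIntegers.ext; rw [hc]; exact hσα
  have ha0 : a ≠ 0 := fun h => hα0 (congrArg (fun x : 𝓞 K => (x : K)) h)
  have haa : a * a = (d : 𝓞 K) := by
    apply RingOfIntegers.ext
    change α * α = algebraMap (𝓞 K) K (d : 𝓞 K)
    rw [map_intCast, ← hα, sq]
  have hint : ∀ x : 𝓞 K, c x = x → ∃ n : ℤ, x = n := by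
    intro x hx
    obtain ⟨r, hr⟩ := hfix x (by rw [← hc, hx])
    have h1 : IsIntegral ℤ (algebraMap ℚ K r) := by rw [hr]; exact x.isIntegral_coe
    have h2 : IsIntegral ℤ r := (isIntegral_algebraMap_iff (algebraMap ℚ K).injective).1 h1
    obtain ⟨n, hn⟩ := IsIntegrallyClosed.isIntegral_iff.1 h2
    refine ⟨n, RingOfIntegers.ext ?_⟩
    rw [← hr, ← hn]
    simp
  choose tr htr using fun x : 𝓞 K => hint (x + c x) (by rw [map_add, hcc, add_comm])
  choose nrm hnrm using fun x : 𝓞 K => hint (x * c x) (by rw [map_mul, hcc, mul_comm])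
  choose θ hθ using fun x : 𝓞 K => hint ((x - c x) * a)
    (by rw [map_mul, map_sub, hcc, hca]; ring)
  let Θ : 𝓞 K →+ ℤ := AddMonoidHom.mk' θ fun x y => by
    have : ((θ (x + y) : ℤ) : 𝓞 K) = ((θ x + θ y : ℤ) : 𝓞 K) := by
      push_cast
      rw [← hθ, ← hθ, ← hθ, map_add]
      ring
    exact_mod_cast this
  have hΘ : ∀ x, (x - c x) * a = (Θ x : 𝓞 K) := hθ
  obtain ⟨g, hg⟩ := Int.subgroup_cyclic Θ.range
  rw [← AddSubgroup.zmultiples_eq_closure] at hg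
  obtain ⟨ω, hω⟩ : g ∈ Θ.range := hg ▸ AddSubgroup.mem_zmultiples g
  have hdvd : ∀ x, ∃ k : ℤ, k * g = Θ x := fun x => by
    have : Θ x ∈ Θ.range := ⟨x, rfl⟩
    rw [hg, AddSubgroup.mem_zmultiples_iff] at this
    simpa using this
  have hg0 : g ≠ 0 := by
    rintro rfl
    obtain ⟨k, hk⟩ := hdvd a
    have h := hΘ a
    rw [← hk, hca, mul_zero, Int.cast_zero] at h
    have h2 : (2 : 𝓞 K) * (a * a) = 0 := by linear_combination h
    exact mul_ne_zero two_ne_zero (mul_ne_zero ha0 ha0) h2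
  choose τ hτ using hdvd
  let T : 𝓞 K →+ ℤ := AddMonoidHom.mk' τ fun x y => by
    apply mul_right_cancel₀ hg0
    rw [hτ, add_mul, hτ, hτ, map_add]
  have hT : ∀ x, T x * g = Θ x := hτ
  set s := ω - c ω with hs
  have hsa : s * a = g := by rw [hs, hΘ, hω]
  have hss : s * s = ((tr ω ^ 2 - 4 * nrm ω : ℤ) : 𝓞 K) := by
    push_cast
    rw [← htr, ← hnrm, hs]
    ring
  have hDg : (tr ω ^ 2 - 4 * nrm ω) * d = g ^ 2 := by
    have : (((tr ω ^ 2 - 4 * nrm ω) * d : ℤ) : 𝓞 K) = ((g ^ 2 : ℤ) : 𝓞 K) := by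
      rw [Int.cast_mul, ← hss, ← haa]
      push_cast
      rw [← hsa]
      ring
    exact_mod_cast this
  exact ⟨{ conj := c
           conj_conj := hcc
           tau := T
           tr := tr
           nrm := nrm
           ω := ω
           D := tr ω ^ 2 - 4 * nrm ω
           D_le := discriminant_le hd hdsf hd1 hd3 hg0 hDg rfl
           disc := hss
           tau_ω := by
             apply mul_right_cancel₀ hg0
             rw [hT, hω, one_mul]
           sub_conj := fun x => by
             apply mul_right_cancel₀ ha0
             rw [hΘ, mul_assoc, hsa, ← hT]
             push_cast
             rfl
           add_conj := htr
           mul_conj := hnrm }⟩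

section NonCongruence

variable (K : Type*) [Field K] [NumberField K]

lemma T_coe (x : 𝓞 K) : (T K x : Matrix (Fin 2) (Fin 2) (𝓞 K)) = !![1, x; 0, 1] := rfl

lemma T_add (x y : 𝓞 K) : T K (x + y) = T K x * T K y := by
  ext i j
  fin_cases i <;> fin_cases j <;>
    simp [Matrix.SpecialLinearGroup.coe_mul, T_coe, Matrix.mul_apply, Fin.sum_univ_two, add_comm]

lemma T_zero : T K 0 = 1 := by
  ext i j
  fin_cases i <;> fin_cases j <;> simp [T_coe]

/-- The additive character of `𝓞` obtained by restricting a character of `SL₂(𝓞)` to the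
upper unipotent matrices. -/
def unipotentChar {A : Type*} [AddGroup A]
    (φ : Matrix.SpecialLinearGroup (Fin 2) (𝓞 K) →* Multiplicative A) : 𝓞 K →+ A where
  toFun x := (φ (T K x)).toAdd
  map_zero' := by rw [T_zero, map_one]; rfl
  map_add' x y := by rw [T_add, map_mul]; rfl

lemma exists_isCoprime_unit {q m : ℕ} (hq : q.Prime) (hm : m ≠ 0)
    (h : Inert K q ∨ 5 ≤ q) (hω : ∃ ω : 𝓞 K, ∀ n : ℤ, ¬ (q : 𝓞 K) ∣ ω + n) :
    ∃ u : 𝓞 K, IsCoprime u (m : 𝓞 K) ∧ IsCoprime (u ^ 2 - 1) (q : 𝓞 K) := by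
  obtain ⟨w, hw0, hw1, hw2⟩ : ∃ w : 𝓞 K, IsCoprime w (q : 𝓞 K) ∧ IsCoprime (w - 1) (q : 𝓞 K) ∧
      IsCoprime (w + 1) (q : 𝓞 K) := by
    rcases h with h | h
    · obtain ⟨ω, hω⟩ := hω
      have hq0 : Ideal.span {(q : 𝓞 K)} ≠ ⊥ := by
        rw [Ne, Ideal.span_singleton_eq_bot]
        exact_mod_cast hq.ne_zero
      have hmax : (Ideal.span {(q : 𝓞 K)}).IsMaximal := Ideal.IsPrime.isMaximal h hq0
      have key : ∀ n : ℤ, IsCoprime (ω + n) (q : 𝓞 K) := fun n => by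
        obtain ⟨y, i, hi, hy⟩ := hmax.exists_inv
          (fun hmem => hω n (Ideal.mem_span_singleton.1 hmem))
        obtain ⟨z, rfl⟩ := Ideal.mem_span_singleton.1 hi
        exact ⟨y, z, by rw [← hy]; ring⟩
      refine ⟨ω, ?_, ?_, ?_⟩
      · simpa using key 0
      · simpa [sub_eq_add_neg] using key (-1)
      · simpa using key 1
    · have key : ∀ n : ℕ, 0 < n → n < q → IsCoprime (n : 𝓞 K) (q : 𝓞 K) := fun n h0 hn => by
        have h1 : Nat.Coprime n q := ((Nat.Prime.coprime_iff_not_dvd hq).2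
          (Nat.not_dvd_of_pos_of_lt h0 hn)).symm
        simpa using (Nat.isCoprime_iff_coprime.2 h1).map (Int.castRingHom (𝓞 K))
      refine ⟨2, ?_, ?_, ?_⟩
      · simpa using key 2 (by omega) (by omega)
      · norm_num [isCoprime_one_left]
      · have h3 := key 3 (by omega) (by omega)
        norm_num at h3 ⊢
        exact h3
  obtain ⟨k, n, hn, rfl⟩ := Nat.exists_eq_pow_mul_and_not_dvd hm q hq.ne_one
  have hcop : IsCoprime (n : ℤ) (q : ℤ) :=
    Nat.isCoprime_iff_coprime.2 ((Nat.Prime.coprime_iff_not_dvd hq).2 hn).symm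
  obtain ⟨x, y, hxy⟩ := hcop.map (Int.castRingHom (𝓞 K))
  simp only [eq_intCast, Int.cast_natCast] at hxy
  have hu : (1 + x * n * (w - 1) : 𝓞 K) = w + q * (y * (1 - w)) := by
    linear_combination (w - 1) * hxy
  refine ⟨1 + x * n * (w - 1), ?_, ?_⟩
  · rw [Nat.cast_mul, Nat.cast_pow]
    refine IsCoprime.mul_right (IsCoprime.pow_right ?_) ?_
    · rw [hu]
      exact hw0.add_mul_left_left _
    · have : (1 + x * n * (w - 1) : 𝓞 K) = 1 + n * (x * (w - 1)) := by ring
      rw [this]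
      exact isCoprime_one_left.add_mul_left_left _
  · have : ((1 + x * n * (w - 1)) ^ 2 - 1 : 𝓞 K) = (w - 1) * (w + 1) +
        q * (y * (1 - w) * (2 * w + q * (y * (1 - w)))) := by
      rw [hu]; ring
    rw [this]
    exact (hw1.mul_left hw2).add_mul_left_left _

lemma exists_diagonal_mod {u m : 𝓞 K} (h : IsCoprime u m) :
    ∃ g : Matrix.SpecialLinearGroup (Fin 2) (𝓞 K), ∃ w b c : 𝓞 K,
      (g : Matrix (Fin 2) (Fin 2) (𝓞 K)) = !![u, m * b; m * c, w] := by
  obtain ⟨w, e, hwe⟩ : IsCoprime u (m * m) := h.mul_right h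
  exact ⟨⟨!![u, m * 1; m * (-e), w], by rw [Matrix.det_fin_two_of]; linear_combination hwe⟩,
    w, 1, -e, rfl⟩

lemma mem_ker_of_congr_one {A : Type*} [AddGroup A] {π : Ideal (𝓞 K)}
    {φ : Matrix.SpecialLinearGroup (Fin 2) (𝓞 K) →* Multiplicative A}
    (hφ : ∀ g, red K π g = 1 → φ g = 1) {g h : Matrix.SpecialLinearGroup (Fin 2) (𝓞 K)}
    (hgh : ∀ i j, g i j - h i j ∈ π) : φ g = φ h := by
  have hred : red K π g = red K π h := by
    ext i j
    exact (Ideal.Quotient.mk_eq_mk_iff_sub_mem _ _).2 (hgh i j)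
  have h1 := hφ (g * h⁻¹) (by rw [map_mul, map_inv, hred, mul_inv_cancel])
  rw [map_mul, map_inv] at h1
  exact mul_inv_eq_one.1 h1

lemma unipotentChar_eq_zero {q : ℕ} (hq : q.Prime) (h : Inert K q ∨ 5 ≤ q)
    (hω : ∃ ω : 𝓞 K, ∀ n : ℤ, ¬ (q : 𝓞 K) ∣ ω + n) {π : Ideal (𝓞 K)} (hπ : π ≠ ⊥)
    (φ : Matrix.SpecialLinearGroup (Fin 2) (𝓞 K) →* Multiplicative (ZMod q))
    (hφ : ∀ g, red K π g = 1 → φ g = 1) : unipotentChar K φ = 0 := by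
  have hm0 : Ideal.absNorm π ≠ 0 := by rwa [Ne, Ideal.absNorm_eq_zero_iff]
  have hmπ : (Ideal.absNorm π : 𝓞 K) ∈ π := Ideal.absNorm_mem π
  obtain ⟨u, hum, a, b, hab⟩ := exists_isCoprime_unit K hq hm0 h hω
  have hmul : ∀ x, unipotentChar K φ ((u ^ 2 - 1) * x) = 0 := by
    intro x
    obtain ⟨g, w, y, z, hg⟩ := exists_diagonal_mod K hum
    have h1 : φ (g * T K x) = φ (T K (u ^ 2 * x) * g) := by
      apply mem_ker_of_congr_one K hφ
      have hdet : u * w - Ideal.absNorm π * y * (Ideal.absNorm π * z) = 1 := by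
        have := g.det_coe
        rwa [hg, Matrix.det_fin_two_of] at this
      have hmem : ∀ t e : 𝓞 K, t = Ideal.absNorm π * e → t ∈ π := fun t e ht =>
        ht ▸ π.mul_mem_right e hmπ
      intro i j
      fin_cases i <;> fin_cases j <;>
        simp only [Matrix.SpecialLinearGroup.coe_mul, T_coe, hg, Matrix.mul_apply,
          Fin.sum_univ_two] <;> simp
      · exact hmem _ (u ^ 2 * x * z) (by ring)
      · exact hmem _ (-u * x * y * Ideal.absNorm π * z) (by linear_combination -u * x * hdet)
      · exact hmem _ (z * x) (by ring)
    rw [map_mul, map_mul, mul_comm] at h1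
    have h2 : unipotentChar K φ x = unipotentChar K φ (u ^ 2 * x) :=
      Multiplicative.ofAdd.injective (mul_right_cancel h1)
    rw [sub_mul, one_mul, map_sub, ← h2, sub_self]
  ext x
  have hx : x = (u ^ 2 - 1) * (a * x) + q • (b * x) := by
    rw [nsmul_eq_mul]
    linear_combination -x * hab
  rw [hx, map_add, hmul, map_nsmul]
  simp

/-- The crossing number as a character of `SL₂(𝓞)` with values in `ℤ/q`. -/
noncomputable def crossingChar (Q : ImagQuadData (𝓞 K)) (q : ℕ) :
    Matrix.SpecialLinearGroup (Fin 2) (𝓞 K) →* Multiplicative (ZMod q) :=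
  MonoidHom.mk' (fun g => Multiplicative.ofAdd (Q.crossing g : ZMod q)) fun g h => by
    rw [Q.crossing_mul, Int.cast_add, ofAdd_add]

/-- The crossing number as a character of `PSL₂(𝓞)` with values in `ℤ/q`. -/
noncomputable def crossingCharPSL (Q : ImagQuadData (𝓞 K)) (q : ℕ) :
    PSL K →* Multiplicative (ZMod q) :=
  QuotientGroup.lift (PM K) (crossingChar K Q q) <| by
    rw [PM, Subgroup.closure_le]
    rintro _ rfl
    simp [crossingChar, Q.crossing_neg_one]

lemma unipotentChar_crossingChar_omega (Q : ImagQuadData (𝓞 K)) (q : ℕ) :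
    unipotentChar K (crossingChar K Q q) Q.ω = -1 := by
  have : unipotentChar K (crossingChar K Q q) Q.ω = ((Q.crossing (T K Q.ω) : ℤ) : ZMod q) := rfl
  rw [this, Q.crossing_upper _ (T_coe K _)]
  simp

lemma crossingCharPSL_proj_T (Q : ImagQuadData (𝓞 K)) (q : ℕ) (x : 𝓞 K) :
    crossingCharPSL K Q q (proj K (T K x)) =
      Multiplicative.ofAdd (unipotentChar K (crossingChar K Q q) x) := rfl

lemma crossingCharPSL_surjective (Q : ImagQuadData (𝓞 K)) (q : ℕ) :
    Function.Surjective (crossingCharPSL K Q q) := by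
  intro y
  obtain ⟨n, hn⟩ := ZMod.intCast_surjective y.toAdd
  refine ⟨proj K (T K ((-n) • Q.ω)), ?_⟩
  rw [crossingCharPSL_proj_T, map_zsmul, unipotentChar_crossingChar_omega]
  simp [hn]

end NonCongruence

/-- **Proposition 5.3.** Let `d < 0` be squarefree with `d ∉ {−1, −3}`, and let
`K = ℚ(√d)` (an imaginary quadratic field, so `B_d = PSL(2, O_d)` where `O_d = 𝓞 K`).
If `q` is a rational prime which is inert in `O_d`, or satisfies `q ≥ 5` and is split in
`O_d`, then `B_d` has a normal non-congruence subgroup of index `q` and level `q`. -/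
theorem bianchi_normal_noncongruence
    (d : ℤ) (hd : d < 0) (hdsf : Squarefree d) (hd1 : d ≠ -1) (hd3 : d ≠ -3)
    (hK2 : Module.finrank ℚ K = 2) (α : K) (hα : α ^ 2 = (d : K))
    (q : ℕ) (hq : q.Prime) (hqsplit : Inert K q ∨ (5 ≤ q ∧ Split K q)) :
    ∃ N : Subgroup (PSL K), N.Normal ∧ ¬ IsCongruence K N ∧
      N.index = q ∧ HasLevelP K N q := by
  obtain ⟨Q⟩ := exists_imagQuadData K d hd hdsf hd1 hd3 hK2 α hα
  have hq1 : (1 : ZMod q) ≠ 0 := by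
    have := Fact.mk hq.one_lt
    exact one_ne_zero
  have hmem : ∀ x, proj K (T K x) ∈ (crossingCharPSL K Q q).ker ↔
      unipotentChar K (crossingChar K Q q) x = 0 := fun x => by
    rw [MonoidHom.mem_ker, crossingCharPSL_proj_T, ofAdd_eq_one]
  refine ⟨(crossingCharPSL K Q q).ker, inferInstance, ?_, ?_, hq.pos, ?_, ?_⟩
  · rintro ⟨π, hπ, hle⟩
    have hω : ∃ ω : 𝓞 K, ∀ n : ℤ, ¬ (q : 𝓞 K) ∣ ω + n := by
      refine ⟨Q.ω, fun n ⟨z, hz⟩ => ?_⟩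
      have htn : Q.tau (n : 𝓞 K) = 0 := Q.tau_eq_of (by simp)
      have h1 := congrArg Q.tau hz
      rw [map_add, htn, Q.tau_ω, ← nsmul_eq_mul, map_nsmul, add_zero, nsmul_eq_mul] at h1
      exact hq.one_lt.ne' (by exact_mod_cast Int.eq_one_of_dvd_one (by omega) ⟨_, h1⟩)
    have h0 := unipotentChar_eq_zero K hq (hqsplit.imp_right And.left) hω hπ
      (crossingChar K Q q) fun g hg => by
        have : proj K g ∈ Gbar K π :=
          ⟨g, by simp only [SetLike.mem_coe, Subgroup.mem_comap, hg, one_mem], rfl⟩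
        exact hle this
    have h1 := unipotentChar_crossingChar_omega K Q q
    rw [h0, AddMonoidHom.zero_apply] at h1
    exact hq1 (neg_eq_zero.1 h1.symm)
  · rw [Subgroup.index_ker, MonoidHom.range_eq_top.2 (crossingCharPSL_surjective K Q q),
      Subgroup.card_top]
    exact Nat.card_zmod q
  · refine Subgroup.normalClosure_le_normal ?_
    rintro _ ⟨a, rfl⟩
    rw [SetLike.mem_coe, hmem, ← nsmul_eq_mul, map_nsmul]
    simp
  · intro k hk hle
    have h := (hmem _).1 (hle (Subgroup.subset_normalClosure ⟨Q.ω, rfl⟩))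
    rw [← nsmul_eq_mul, map_nsmul, unipotentChar_crossingChar_omega] at h
    have h' : (k : ZMod q) = 0 := by simpa using h
    exact Nat.le_of_dvd hk ((ZMod.natCast_eq_zero_iff k q).1 h')
end
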